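/- arXiv:2602.06670 — 7 statements merged into one kernel-verified Lean document; each statement's English description precedes it below -/
import Mathlib

section
/- Let X and U be real Hilbert spaces, let M₀ : X → X be a monotone map (i.e. ⟪M₀ a − M₀ b, a − b⟫ ≥ 0 for all a, b ∈ X), and let B : U →L[ℝ] X be a bounded linear operator with Hilbert-space adjoint B*. Let (x̄, ū) ∈ X × U be a steady-state pair, i.e. M₀ x̄ = B ū. Suppose x : ℝ → X and u : ℝ → U are such that at a time t the map x has derivative −M₀ (x t) + B (u t) (in the sense of HasDerivAt). Then the function s ↦ (1/2)‖x s − x̄‖² has derivative at t equal to −⟪x t − x̄, M₀ (x t) − M₀ x̄⟫ + ⟪B* (x t) − B* x̄, u t − ū⟫, and this derivative is at most ⟪B* (x t) − B* x̄, u t − ū⟫ (shifted passivity inequality, Proposition 2.3). -/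
open scoped RealInnerProductSpace

/-- **Proposition 2.3 (shifted passivity).** If `M₀` is monotone, `(xbar, ubar)` is a
steady-state pair (`M₀ xbar = B ubar`) and `x` solves `x' = -M₀ x + B u` at time `t`, then
`s ↦ ½‖x s - xbar‖²` has derivative
`-⟪x t - xbar, M₀ (x t) - M₀ xbar⟫ + ⟪B* (x t) - B* xbar, u t - ubar⟫` at `t`, which is
bounded above by `⟪B* (x t) - B* xbar, u t - ubar⟫`. -/
theorem shifted_passivity
    {X U : Type*}
    [NormedAddCommGroup X] [InnerProductSpace ℝ X] [CompleteSpace X]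
    [NormedAddCommGroup U] [InnerProductSpace ℝ U] [CompleteSpace U]
    (M₀ : X → X)
    (hmono : ∀ a b : X, 0 ≤ ⟪M₀ a - M₀ b, a - b⟫)
    (B : U →L[ℝ] X) (xbar : X) (ubar : U)
    (hss : M₀ xbar = B ubar)
    (x : ℝ → X) (u : ℝ → U) (t : ℝ)
    (hx : HasDerivAt x (-M₀ (x t) + B (u t)) t) :
    HasDerivAt (fun s => (1 / 2 : ℝ) * ‖x s - xbar‖ ^ 2)
      (-⟪x t - xbar, M₀ (x t) - M₀ xbar⟫
        + ⟪(ContinuousLinearMap.adjoint B) (x t) - (ContinuousLinearMap.adjoint B) xbar,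
            u t - ubar⟫) t
    ∧ -⟪x t - xbar, M₀ (x t) - M₀ xbar⟫
        + ⟪(ContinuousLinearMap.adjoint B) (x t) - (ContinuousLinearMap.adjoint B) xbar,
            u t - ubar⟫
      ≤ ⟪(ContinuousLinearMap.adjoint B) (x t) - (ContinuousLinearMap.adjoint B) xbar,
            u t - ubar⟫ := by
  constructor
  · refine (((hx.sub_const xbar).norm_sq).const_mul (1 / 2 : ℝ)).congr_deriv ?_
    rw [← map_sub, ContinuousLinearMap.adjoint_inner_left, map_sub B, ← hss]
    simp only [inner_add_right, inner_sub_right, inner_neg_right]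
    ring
  · have h := hmono (x t) xbar
    rw [real_inner_comm] at h
    linarith
end

section
/- Let X₁, X₂, U₁, U₂ be real Hilbert spaces, let M₁ ⊆ X₁ × X₁ and M₂ ⊆ X₂ × X₂ be set-valued operators (relations), let B₁ : U₁ →L[ℝ] X₁ and B₂ : U₂ →L[ℝ] X₂ be bounded linear operators, and let ℰ : U₂ →L[ℝ] U₁ be bounded linear. Define the relation M on X₁ × X₂ by: ((x₁, x₂), (z₁, z₂)) ∈ M if and only if there exist y₁, y₂ with (x₁, y₁) ∈ M₁, (x₂, y₂) ∈ M₂, z₁ = y₁ − B₁ (ℰ (B₂* x₂)) and z₂ = y₂ + B₂ (ℰ* (B₁* x₁)). Then: (i) if M₁ and M₂ are monotone, M is monotone; (ii) if M₁ and M₂ are maximally monotone, M is maximally monotone (Proposition 2.4: power-preserving interconnection of maximally monotone pH systems). -/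
open scoped RealInnerProductSpace

/-- A set-valued operator (relation) on a real Hilbert space is monotone. -/
def IsMonotoneRel {X : Type*} [NormedAddCommGroup X] [InnerProductSpace ℝ X]
    (M : Set (X × X)) : Prop :=
  ∀ p ∈ M, ∀ q ∈ M, (0 : ℝ) ≤ ⟪p.1 - q.1, p.2 - q.2⟫

/-- A relation is maximally monotone if it is monotone and has no proper monotone
extension. -/
def IsMaxMonotoneRel {X : Type*} [NormedAddCommGroup X] [InnerProductSpace ℝ X]
    (M : Set (X × X)) : Prop :=
  IsMonotoneRel M ∧ ∀ N : Set (X × X), IsMonotoneRel N → M ⊆ N → N = M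

/-- Monotonicity of a relation on the product `X₁ × X₂`, with respect to the product
Hilbert structure `⟪(a₁,a₂),(b₁,b₂)⟫ = ⟪a₁,b₁⟫ + ⟪a₂,b₂⟫`. -/
def IsMonotoneRelProd {X₁ X₂ : Type*}
    [NormedAddCommGroup X₁] [InnerProductSpace ℝ X₁]
    [NormedAddCommGroup X₂] [InnerProductSpace ℝ X₂]
    (M : Set ((X₁ × X₂) × (X₁ × X₂))) : Prop :=
  ∀ p ∈ M, ∀ q ∈ M,
    (0 : ℝ) ≤ ⟪p.1.1 - q.1.1, p.2.1 - q.2.1⟫ + ⟪p.1.2 - q.1.2, p.2.2 - q.2.2⟫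

/-- Maximal monotonicity on the product space. -/
def IsMaxMonotoneRelProd {X₁ X₂ : Type*}
    [NormedAddCommGroup X₁] [InnerProductSpace ℝ X₁]
    [NormedAddCommGroup X₂] [InnerProductSpace ℝ X₂]
    (M : Set ((X₁ × X₂) × (X₁ × X₂))) : Prop :=
  IsMonotoneRelProd M ∧
    ∀ N : Set ((X₁ × X₂) × (X₁ × X₂)), IsMonotoneRelProd N → M ⊆ N → N = M

/-- A pair monotonically related to every element of a maximally monotone relation
belongs to it. -/
theorem IsMaxMonotoneRel.mem_of_forall_inner_nonneg {X : Type*} [NormedAddCommGroup X]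
    [InnerProductSpace ℝ X] {M : Set (X × X)} (hM : IsMaxMonotoneRel M) {p : X × X}
    (hp : ∀ q ∈ M, (0 : ℝ) ≤ ⟪p.1 - q.1, p.2 - q.2⟫) : p ∈ M := by
  have hmono : IsMonotoneRel (insert p M) := by
    rintro a (rfl | ha) b (rfl | hb)
    · simp
    · exact hp b hb
    · rw [← neg_sub, ← neg_sub b.2, inner_neg_neg]
      exact hp a ha
    · exact hM.1 a ha b hb
  rw [← hM.2 _ hmono (Set.subset_insert p M)]
  exact Set.mem_insert p M

/-- The product of two maximally monotone relations contains every pair of points that is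
monotonically related to it. -/
theorem IsMaxMonotoneRel.mem_and_mem_of_forall_inner_add_nonneg {X₁ X₂ : Type*}
    [NormedAddCommGroup X₁] [InnerProductSpace ℝ X₁]
    [NormedAddCommGroup X₂] [InnerProductSpace ℝ X₂]
    {M₁ : Set (X₁ × X₁)} {M₂ : Set (X₂ × X₂)}
    (h₁ : IsMaxMonotoneRel M₁) (h₂ : IsMaxMonotoneRel M₂) {p₁ : X₁ × X₁} {p₂ : X₂ × X₂}
    (hp : ∀ q₁ ∈ M₁, ∀ q₂ ∈ M₂,
      (0 : ℝ) ≤ ⟪p₁.1 - q₁.1, p₁.2 - q₁.2⟫ + ⟪p₂.1 - q₂.1, p₂.2 - q₂.2⟫) :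
    p₁ ∈ M₁ ∧ p₂ ∈ M₂ := by
  have hp₁ : p₁ ∈ M₁ := by
    by_contra hnot
    obtain ⟨q₁, hq₁, hneg⟩ : ∃ q₁ ∈ M₁, ⟪p₁.1 - q₁.1, p₁.2 - q₁.2⟫ < (0 : ℝ) := by
      by_contra! hnonneg
      exact hnot (h₁.mem_of_forall_inner_nonneg hnonneg)
    have hp₂ : p₂ ∈ M₂ := h₂.mem_of_forall_inner_nonneg fun q₂ hq₂ ↦ by
      linarith [hp q₁ hq₁ q₂ hq₂]
    have := hp q₁ hq₁ p₂ hp₂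
    simp only [sub_self, inner_zero_left, add_zero] at this
    linarith
  refine ⟨hp₁, h₂.mem_of_forall_inner_nonneg fun q₂ hq₂ ↦ ?_⟩
  simpa using hp p₁ hp₁ q₂ hq₂

/-- The interconnection law is skew-symmetric, hence does not affect the monotonicity
pairing. -/
theorem inner_interconnection_eq {X₁ X₂ U₁ U₂ : Type*}
    [NormedAddCommGroup X₁] [InnerProductSpace ℝ X₁] [CompleteSpace X₁]
    [NormedAddCommGroup X₂] [InnerProductSpace ℝ X₂] [CompleteSpace X₂]
    [NormedAddCommGroup U₁] [InnerProductSpace ℝ U₁] [CompleteSpace U₁]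
    [NormedAddCommGroup U₂] [InnerProductSpace ℝ U₂] [CompleteSpace U₂]
    (B₁ : U₁ →L[ℝ] X₁) (B₂ : U₂ →L[ℝ] X₂) (E : U₂ →L[ℝ] U₁)
    (x₁ a₁ y₁ b₁ : X₁) (x₂ a₂ y₂ b₂ : X₂) :
    ⟪x₁ - a₁, (y₁ - B₁ (E (B₂.adjoint x₂))) - (b₁ - B₁ (E (B₂.adjoint a₂)))⟫ +
      ⟪x₂ - a₂, (y₂ + B₂ (E.adjoint (B₁.adjoint x₁))) -
        (b₂ + B₂ (E.adjoint (B₁.adjoint a₁)))⟫ =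
      ⟪x₁ - a₁, y₁ - b₁⟫ + ⟪x₂ - a₂, y₂ - b₂⟫ := by
  have hskew : ⟪x₁ - a₁, B₁ (E (B₂.adjoint (x₂ - a₂)))⟫ =
      ⟪x₂ - a₂, B₂ (E.adjoint (B₁.adjoint (x₁ - a₁)))⟫ := by
    rw [← ContinuousLinearMap.adjoint_inner_left, ← ContinuousLinearMap.adjoint_inner_left,
      ← ContinuousLinearMap.adjoint_inner_left, real_inner_comm,
      ContinuousLinearMap.adjoint_adjoint]
  rw [sub_sub_sub_comm, add_sub_add_comm]
  simp only [← map_sub]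
  rw [inner_sub_right, inner_add_right, hskew]
  ring

/-- **Proposition 2.4.** The power-preserving interconnection of two (maximally) monotone
pH systems through the skew-symmetric interconnection law induced by `ℰ` is again a
(maximally) monotone relation on the product space. -/
theorem interconnection_monotone
    {X₁ X₂ U₁ U₂ : Type*}
    [NormedAddCommGroup X₁] [InnerProductSpace ℝ X₁] [CompleteSpace X₁]
    [NormedAddCommGroup X₂] [InnerProductSpace ℝ X₂] [CompleteSpace X₂]
    [NormedAddCommGroup U₁] [InnerProductSpace ℝ U₁] [CompleteSpace U₁]
    [NormedAddCommGroup U₂] [InnerProductSpace ℝ U₂] [CompleteSpace U₂]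
    (M₁ : Set (X₁ × X₁)) (M₂ : Set (X₂ × X₂))
    (B₁ : U₁ →L[ℝ] X₁) (B₂ : U₂ →L[ℝ] X₂) (E : U₂ →L[ℝ] U₁)
    (M : Set ((X₁ × X₂) × (X₁ × X₂)))
    (hM : M = {p : (X₁ × X₂) × (X₁ × X₂) |
      ∃ y₁ y₂, (p.1.1, y₁) ∈ M₁ ∧ (p.1.2, y₂) ∈ M₂ ∧
        p.2.1 = y₁ - B₁ (E ((ContinuousLinearMap.adjoint B₂) p.1.2)) ∧
        p.2.2 = y₂ + B₂ ((ContinuousLinearMap.adjoint E)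
          ((ContinuousLinearMap.adjoint B₁) p.1.1))}) :
    (IsMonotoneRel M₁ → IsMonotoneRel M₂ → IsMonotoneRelProd M) ∧
    (IsMaxMonotoneRel M₁ → IsMaxMonotoneRel M₂ → IsMaxMonotoneRelProd M) := by
  have hmono : IsMonotoneRel M₁ → IsMonotoneRel M₂ → IsMonotoneRelProd M := by
    subst hM
    rintro h₁ h₂ p ⟨y₁, y₂, hy₁, hy₂, hp₁, hp₂⟩ q ⟨b₁, b₂, hb₁, hb₂, hq₁, hq₂⟩
    rw [hp₁, hp₂, hq₁, hq₂, inner_interconnection_eq]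
    exact add_nonneg (h₁ _ hy₁ _ hb₁) (h₂ _ hy₂ _ hb₂)
  refine ⟨hmono, fun h₁ h₂ ↦ ⟨hmono h₁.1 h₂.1, fun N hN hMN ↦ ?_⟩⟩
  refine Set.Subset.antisymm ?_ hMN
  subst hM
  rintro ⟨⟨x₁, x₂⟩, z₁, z₂⟩ hp
  obtain ⟨y₁, rfl⟩ : ∃ y₁, z₁ = y₁ - B₁ (E (B₂.adjoint x₂)) :=
    ⟨_, (add_sub_cancel_right _ _).symm⟩
  obtain ⟨y₂, rfl⟩ : ∃ y₂, z₂ = y₂ + B₂ (E.adjoint (B₁.adjoint x₁)) :=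
    ⟨_, (sub_add_cancel _ _).symm⟩
  obtain ⟨hy₁, hy₂⟩ : (x₁, y₁) ∈ M₁ ∧ (x₂, y₂) ∈ M₂ := by
    refine h₁.mem_and_mem_of_forall_inner_add_nonneg h₂ ?_
    rintro ⟨a₁, b₁⟩ hq₁ ⟨a₂, b₂⟩ hq₂
    have h := hN _ hp ((a₁, a₂), (b₁ - B₁ (E (B₂.adjoint a₂)),
      b₂ + B₂ (E.adjoint (B₁.adjoint a₁)))) (hMN ⟨b₁, b₂, hq₁, hq₂, rfl, rfl⟩)
    rwa [inner_interconnection_eq] at h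
  exact ⟨y₁, y₂, hy₁, hy₂, rfl, rfl⟩
end

section
/- Let X be a real Hilbert space, let M ⊆ X × X be a maximally monotone relation, and let K : X →L[ℝ] X be a bounded linear operator that is skew-adjoint, i.e. K* = −K (equivalently ⟪K x, x⟫ = 0 for all x). Then the perturbed relation M + K := {(x, y + K x) | (x, y) ∈ M} is maximally monotone. In particular, if M is merely monotone, then M + K is monotone (key step in the proof of Proposition 2.4). -/
open scoped RealInnerProductSpace

theorem inner_map_self_eq_zero_of_adjoint_eq_neg
    {X : Type*} [NormedAddCommGroup X] [InnerProductSpace ℝ X] [CompleteSpace X]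
    {K : X →L[ℝ] X} (hskew : ContinuousLinearMap.adjoint K = -K) (x : X) :
    ⟪x, K x⟫ = 0 := by
  have h := ContinuousLinearMap.adjoint_inner_left K x x
  rw [hskew, neg_apply, inner_neg_left, real_inner_comm] at h
  linarith

theorem IsMonotoneRel.add_skew
    {X : Type*} [NormedAddCommGroup X] [InnerProductSpace ℝ X] {M : Set (X × X)}
    (hM : IsMonotoneRel M) {K : X →L[ℝ] X} (hK : ∀ x, ⟪x, K x⟫ = 0) :
    IsMonotoneRel {p : X × X | ∃ y, (p.1, y) ∈ M ∧ p.2 = y + K p.1} := by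
  rintro p ⟨y₁, h₁, hp⟩ q ⟨y₂, h₂, hq⟩
  rw [hp, hq, add_sub_add_comm, ← map_sub, inner_add_right, hK, add_zero]
  exact hM _ h₁ _ h₂

theorem IsMaxMonotoneRel.add_skew
    {X : Type*} [NormedAddCommGroup X] [InnerProductSpace ℝ X] {M : Set (X × X)}
    (hM : IsMaxMonotoneRel M) {K : X →L[ℝ] X} (hK : ∀ x, ⟪x, K x⟫ = 0) :
    IsMaxMonotoneRel {p : X × X | ∃ y, (p.1, y) ∈ M ∧ p.2 = y + K p.1} := by
  refine ⟨hM.1.add_skew hK, fun N hN hMN => Set.Subset.antisymm ?_ hMN⟩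
  have hN' := hN.add_skew (K := -K) (by simp [hK])
  have hNM := hM.2 _ hN' fun p hp => ⟨p.2 + K p.1, hMN ⟨p.2, hp, rfl⟩, by simp⟩
  intro p hp
  refine ⟨p.2 - K p.1, ?_, by simp⟩
  rw [← hNM]
  exact ⟨p.2, hp, by simp [sub_eq_add_neg]⟩

/-- **Key step of Proposition 2.4.** Perturbing a maximally monotone relation `M` by a
bounded skew-adjoint linear operator `K` (i.e. `K* = -K`) preserves maximal
monotonicity; perturbing a monotone relation preserves monotonicity. -/
theorem skew_perturbation_monotone
    {X : Type*} [NormedAddCommGroup X] [InnerProductSpace ℝ X] [CompleteSpace X]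
    (M : Set (X × X)) (K : X →L[ℝ] X)
    (hskew : ContinuousLinearMap.adjoint K = -K) :
    (IsMaxMonotoneRel M →
      IsMaxMonotoneRel {p : X × X | ∃ y, (p.1, y) ∈ M ∧ p.2 = y + K p.1}) ∧
    (IsMonotoneRel M →
      IsMonotoneRel {p : X × X | ∃ y, (p.1, y) ∈ M ∧ p.2 = y + K p.1}) := by
  have hK := inner_map_self_eq_zero_of_adjoint_eq_neg hskew
  exact ⟨fun hM => hM.add_skew hK, fun hM => hM.add_skew hK⟩
end

section
/- Let H, X₁, X₂, U₁, U₂ be real Hilbert spaces, let B₁ : U₁ →L[ℝ] X₁, B₂ : U₂ →L[ℝ] X₂, 𝓕₁ : U₁ →L[ℝ] H, 𝓕₂ : U₂ →L[ℝ] H be bounded linear operators, let ℰ : H → H be firmly nonexpansive, and let c > 0. Define K : X₁ × X₂ → X₁ × X₂ by K (x₁, x₂) = ( c • B₁ (𝓕₁* (ℰ (𝓕₁ (B₁* x₁)) − ℰ (𝓕₂ (B₂* x₂)))), −c • B₂ (𝓕₂* (ℰ (𝓕₁ (B₁* x₁)) − ℰ (𝓕₂ (B₂* x₂)))) ). Then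 for all (x₁, x₂) ∈ X₁ × X₂ one has ⟪K (x₁, x₂), (x₁, x₂)⟫ ≥ c ‖ℰ (𝓕₁ (B₁* x₁)) − ℰ (𝓕₂ (B₂* x₂))‖² ≥ 0. Consequently, if M₁ ⊆ X₁ × X₁ and M₂ ⊆ X₂ × X₂ are relative monotone with respect to 0, then the relation M = {((x₁, x₂), (y₁, y₂) + K (x₁, x₂)) | (x₁, y₁) ∈ M₁, (x₂, y₂) ∈ M₂} is relative monotone with respect to 0 (Proposition 2.5: interconnection via a firmly nonexpansive operator). -/
open scoped RealInnerProductSpace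

/-- A relation `M ⊆ X × X` is relative monotone with respect to `0` if `⟪y, x⟫ ≥ 0`
for all `(x, y) ∈ M`. -/
def IsRelMonotoneRel {X : Type*} [NormedAddCommGroup X] [InnerProductSpace ℝ X]
    (M : Set (X × X)) : Prop :=
  ∀ p ∈ M, (0 : ℝ) ≤ ⟪p.2, p.1⟫

/-- Relative monotonicity w.r.t. `0` of a relation on the product `X₁ × X₂`, with the
product Hilbert structure `⟪(a₁,a₂),(b₁,b₂)⟫ = ⟪a₁,b₁⟫ + ⟪a₂,b₂⟫`. -/
def IsRelMonotoneRelProd {X₁ X₂ : Type*}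
    [NormedAddCommGroup X₁] [InnerProductSpace ℝ X₁]
    [NormedAddCommGroup X₂] [InnerProductSpace ℝ X₂]
    (M : Set ((X₁ × X₂) × (X₁ × X₂))) : Prop :=
  ∀ p ∈ M, (0 : ℝ) ≤ ⟪p.2.1, p.1.1⟫ + ⟪p.2.2, p.1.2⟫

/-- Moving `B` and `F*` across the inner product: `⟪B F* d, x⟫ = ⟪d, F B* x⟫`. -/
theorem inner_apply_adjoint {H X U : Type*}
    [NormedAddCommGroup H] [InnerProductSpace ℝ H] [CompleteSpace H]
    [NormedAddCommGroup X] [InnerProductSpace ℝ X] [CompleteSpace X]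
    [NormedAddCommGroup U] [InnerProductSpace ℝ U] [CompleteSpace U]
    (B : U →L[ℝ] X) (F : U →L[ℝ] H) (d : H) (x : X) :
    ⟪B (ContinuousLinearMap.adjoint F d), x⟫ = ⟪d, F (ContinuousLinearMap.adjoint B x)⟫ := by
  rw [← ContinuousLinearMap.adjoint_inner_right, ContinuousLinearMap.adjoint_inner_left]

/-- **Proposition 2.5.** Interconnection via a firmly nonexpansive operator `ℰ`:
the coupling map `K` satisfies
`⟪K (x₁,x₂), (x₁,x₂)⟫ ≥ c‖ℰ(𝓕₁ B₁* x₁) - ℰ(𝓕₂ B₂* x₂)‖² ≥ 0`, and consequently the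
interconnection of two relative monotone systems is again relative monotone w.r.t. `0`. -/
theorem firmly_nonexpansive_interconnection
    {H X₁ X₂ U₁ U₂ : Type*}
    [NormedAddCommGroup H] [InnerProductSpace ℝ H] [CompleteSpace H]
    [NormedAddCommGroup X₁] [InnerProductSpace ℝ X₁] [CompleteSpace X₁]
    [NormedAddCommGroup X₂] [InnerProductSpace ℝ X₂] [CompleteSpace X₂]
    [NormedAddCommGroup U₁] [InnerProductSpace ℝ U₁] [CompleteSpace U₁]
    [NormedAddCommGroup U₂] [InnerProductSpace ℝ U₂] [CompleteSpace U₂]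
    (B₁ : U₁ →L[ℝ] X₁) (B₂ : U₂ →L[ℝ] X₂)
    (F₁ : U₁ →L[ℝ] H) (F₂ : U₂ →L[ℝ] H)
    (E : H → H)
    (hE : ∀ x y : H, ‖E x - E y‖ ^ 2 ≤ ⟪E x - E y, x - y⟫)
    (c : ℝ) (hc : 0 < c)
    (K : X₁ × X₂ → X₁ × X₂)
    (hK : ∀ x : X₁ × X₂, K x =
      (c • B₁ ((ContinuousLinearMap.adjoint F₁)
          (E (F₁ ((ContinuousLinearMap.adjoint B₁) x.1))
            - E (F₂ ((ContinuousLinearMap.adjoint B₂) x.2)))),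
       -c • B₂ ((ContinuousLinearMap.adjoint F₂)
          (E (F₁ ((ContinuousLinearMap.adjoint B₁) x.1))
            - E (F₂ ((ContinuousLinearMap.adjoint B₂) x.2)))))) :
    (∀ x : X₁ × X₂,
      c * ‖E (F₁ ((ContinuousLinearMap.adjoint B₁) x.1))
            - E (F₂ ((ContinuousLinearMap.adjoint B₂) x.2))‖ ^ 2
        ≤ ⟪(K x).1, x.1⟫ + ⟪(K x).2, x.2⟫ ∧
      (0 : ℝ) ≤ c * ‖E (F₁ ((ContinuousLinearMap.adjoint B₁) x.1))
            - E (F₂ ((ContinuousLinearMap.adjoint B₂) x.2))‖ ^ 2) ∧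
    (∀ M₁ : Set (X₁ × X₁), ∀ M₂ : Set (X₂ × X₂),
      IsRelMonotoneRel M₁ → IsRelMonotoneRel M₂ →
      IsRelMonotoneRelProd {p : (X₁ × X₂) × (X₁ × X₂) |
        ∃ y₁ y₂, (p.1.1, y₁) ∈ M₁ ∧ (p.1.2, y₂) ∈ M₂ ∧
          p.2 = ((y₁, y₂) : X₁ × X₂) + K p.1}) := by
  have coupling_bound (x : X₁ × X₂) :
      c * ‖E (F₁ (ContinuousLinearMap.adjoint B₁ x.1))
          - E (F₂ (ContinuousLinearMap.adjoint B₂ x.2))‖ ^ 2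
        ≤ ⟪(K x).1, x.1⟫ + ⟪(K x).2, x.2⟫ := by
    have h := mul_le_mul_of_nonneg_left
      (hE (F₁ (ContinuousLinearMap.adjoint B₁ x.1))
        (F₂ (ContinuousLinearMap.adjoint B₂ x.2))) hc.le
    rw [inner_sub_right] at h
    simp only [hK, real_inner_smul_left]
    rw [inner_apply_adjoint, inner_apply_adjoint]
    linarith
  refine ⟨fun x => ⟨coupling_bound x, by positivity⟩, ?_⟩
  rintro M₁ M₂ hM₁ hM₂ p ⟨y₁, y₂, h₁, h₂, hz⟩
  have hy₁ : 0 ≤ ⟪y₁, p.1.1⟫ := hM₁ _ h₁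
  have hy₂ : 0 ≤ ⟪y₂, p.1.2⟫ := hM₂ _ h₂
  have hKp : 0 ≤ ⟪(K p.1).1, p.1.1⟫ + ⟪(K p.1).2, p.1.2⟫ :=
    le_trans (by positivity) (coupling_bound p.1)
  rw [hz]
  simp only [Prod.fst_add, Prod.snd_add, inner_add_left]
  linarith
end

section
/- Let X be a real Hilbert space. Let T : ℝ → (X →L[ℝ] X) satisfy: T 0 = id; ‖T t y‖ = ‖y‖ for all t ≥ 0 and y ∈ X; and for each y ∈ X the map t ↦ T t y is continuous. Let 𝔅 : X → X be continuous and monotone. Let U : ℝ → X → X be such that for each x ∈ X the map s ↦ U s x is continuous, and the variation-of-parameters identity U t x = T t x − ∫₀ᵗ T (t − s) (𝔅 (U s x)) ds (Bochner integral over [0, t]) holds for all t ≥ 0 and x ∈ X. Then for every x ∈ X the limit as t → 0⁺ of (‖U t x‖² − ‖x‖²) / (2 t) exists and equals −⟪x, 𝔅 x⟫. In particular, the upper Dini derivative of V(x) = (1/2)‖x‖² along the flow U equals −⟪𝔅 x, x⟫, so its level set to the value c is { x ∈ X | −⟪𝔅 x, x⟫ = c } (Theorem 4.3). -/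
open scoped RealInnerProductSpace
open Filter

/-- A strongly continuous family of linear isometries is jointly continuous. -/
theorem continuousOn_uncurry_of_norm_map {X : Type*} [NormedAddCommGroup X] [NormedSpace ℝ X]
    {T : ℝ → X →L[ℝ] X} {S : Set ℝ} (hTiso : ∀ t ∈ S, ∀ y : X, ‖T t y‖ = ‖y‖)
    (hTcont : ∀ y : X, Continuous fun t => T t y) :
    ContinuousOn (fun p : ℝ × X => T p.1 p.2) (S ×ˢ Set.univ) := by
  refine continuousOn_prod_of_continuousOn_lipschitzOnWith' _ 1
    (fun t ht => ?_) fun y _ => (hTcont y).continuousOn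
  refine LipschitzOnWith.of_dist_le_mul fun a _ b _ => ?_
  simp only [NNReal.coe_one, one_mul, dist_eq_norm]
  rw [← map_sub, hTiso t ht]

/-- The convolution of a strongly continuous family of isometries starting at the identity with a
continuous function `g` has right derivative `g 0` at `0`. -/
theorem tendsto_inv_smul_integral_convolution {X : Type*} [NormedAddCommGroup X]
    [NormedSpace ℝ X] [CompleteSpace X] {T : ℝ → X →L[ℝ] X}
    (hT0 : T 0 = ContinuousLinearMap.id ℝ X)
    (hTiso : ∀ t : ℝ, 0 ≤ t → ∀ y : X, ‖T t y‖ = ‖y‖)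
    (hTcont : ∀ y : X, Continuous fun t => T t y) {g : ℝ → X} (hg : Continuous g) :
    Tendsto (fun t : ℝ => t⁻¹ • ∫ s in (0 : ℝ)..t, T (t - s) (g s))
      (nhdsWithin 0 (Set.Ioi 0)) (nhds (g 0)) := by
  rw [Metric.tendsto_nhdsWithin_nhds]
  intro ε hε
  obtain ⟨δ₁, hδ₁, hg₁⟩ := Metric.continuous_iff.1 hg 0 (ε / 4) (by positivity)
  obtain ⟨δ₂, hδ₂, hT₂⟩ := Metric.continuous_iff.1 (hTcont (g 0)) 0 (ε / 4) (by positivity)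
  refine ⟨min δ₁ δ₂, lt_min hδ₁ hδ₂, fun {t} ht htδ => ?_⟩
  have ht0 : 0 < t := ht
  rw [Real.dist_0_eq_abs, abs_of_pos ht0, lt_min_iff] at htδ
  have hint : IntervalIntegrable (fun s => T (t - s) (g s)) MeasureTheory.volume 0 t := by
    refine ContinuousOn.intervalIntegrable ?_
    rw [Set.uIcc_of_le ht0.le]
    exact (continuousOn_uncurry_of_norm_map (S := Set.Ici 0) hTiso hTcont).comp
      (f := fun s => (t - s, g s)) (by fun_prop)
      fun s hs => ⟨sub_nonneg.2 hs.2, Set.mem_univ _⟩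
  have hbound : ‖∫ s in (0 : ℝ)..t, (T (t - s) (g s) - g 0)‖ ≤ ε / 2 * |t - 0| := by
    refine intervalIntegral.norm_integral_le_of_norm_le_const fun s hs => ?_
    rw [Set.uIoc_of_le ht0.le] at hs
    have h₁ : ‖T (t - s) (g s - g 0)‖ < ε / 4 := by
      rw [hTiso _ (sub_nonneg.2 hs.2), ← dist_eq_norm]
      refine hg₁ s ?_
      rw [Real.dist_0_eq_abs, abs_of_pos hs.1]
      linarith [hs.2]
    have h₂ : ‖T (t - s) (g 0) - g 0‖ < ε / 4 := by
      have := hT₂ (t - s) (by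
        rw [Real.dist_0_eq_abs, abs_of_nonneg (sub_nonneg.2 hs.2)]
        linarith [hs.1])
      simpa [hT0, dist_eq_norm] using this
    calc ‖T (t - s) (g s) - g 0‖
        = ‖T (t - s) (g s - g 0) + (T (t - s) (g 0) - g 0)‖ := by rw [map_sub]; abel_nf
      _ ≤ ‖T (t - s) (g s - g 0)‖ + ‖T (t - s) (g 0) - g 0‖ := norm_add_le _ _
      _ ≤ ε / 2 := by linarith
  rw [intervalIntegral.integral_sub hint intervalIntegrable_const,
    intervalIntegral.integral_const, sub_zero, abs_of_pos ht0] at hbound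
  have heq : (t⁻¹ • ∫ s in (0 : ℝ)..t, T (t - s) (g s)) - g 0 =
      t⁻¹ • ((∫ s in (0 : ℝ)..t, T (t - s) (g s)) - t • g 0) := by
    rw [smul_sub, inv_smul_smul₀ ht0.ne']
  rw [dist_eq_norm, heq, norm_smul, Real.norm_eq_abs, abs_of_pos (inv_pos.2 ht0)]
  calc t⁻¹ * ‖(∫ s in (0 : ℝ)..t, T (t - s) (g s)) - t • g 0‖
      ≤ t⁻¹ * (ε / 2 * t) := by gcongr
    _ = ε / 2 := by field_simp
    _ < ε := half_lt_self hε

/-- **Theorem 4.3.** Let `T` be a strongly continuous family of linear isometries with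
`T 0 = id`, `𝔅` continuous and monotone, and `U` the nonlinear flow defined through the
variation-of-parameters identity `U t x = T t x - ∫₀ᵗ T (t-s) (𝔅 (U s x)) ds`. Then for
every `x` the right limit of `(‖U t x‖² - ‖x‖²)/(2t)` at `0` exists and equals
`-⟪x, 𝔅 x⟫`; hence the upper Dini derivative of `V(x) = ½‖x‖²` along the flow has level
sets `{x | -⟪𝔅 x, x⟫ = c}`. -/
theorem dini_derivative_levelsets
    {X : Type*} [NormedAddCommGroup X] [InnerProductSpace ℝ X] [CompleteSpace X]
    (T : ℝ → X →L[ℝ] X)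
    (hT0 : T 0 = ContinuousLinearMap.id ℝ X)
    (hTiso : ∀ t : ℝ, 0 ≤ t → ∀ y : X, ‖T t y‖ = ‖y‖)
    (hTcont : ∀ y : X, Continuous fun t => T t y)
    (B : X → X) (hBcont : Continuous B)
    (hBmono : ∀ a b : X, 0 ≤ ⟪B a - B b, a - b⟫)
    (U : ℝ → X → X)
    (hUcont : ∀ x : X, Continuous fun s => U s x)
    (hU : ∀ t : ℝ, 0 ≤ t → ∀ x : X,
      U t x = T t x - ∫ s in (0 : ℝ)..t, T (t - s) (B (U s x)))
    (Vdot : X → ℝ)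
    (hVdot : ∀ x : X, Vdot x =
      limsup (fun t => ((1 / 2 : ℝ) * ‖U t x‖ ^ 2 - (1 / 2 : ℝ) * ‖x‖ ^ 2) / t)
        (nhdsWithin 0 (Set.Ioi 0))) :
    (∀ x : X,
      Tendsto (fun t => (‖U t x‖ ^ 2 - ‖x‖ ^ 2) / (2 * t))
        (nhdsWithin 0 (Set.Ioi 0)) (nhds (-⟪x, B x⟫))) ∧
    (∀ c : ℝ, {x : X | Vdot x = c} = {x : X | -⟪B x, x⟫ = c}) := by
  have hlim : ∀ x : X, Tendsto (fun t => (‖U t x‖ ^ 2 - ‖x‖ ^ 2) / (2 * t))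
      (nhdsWithin 0 (Set.Ioi 0)) (nhds (-⟪x, B x⟫)) := by
    intro x
    have hU0 : U 0 x = x := by simpa [hT0] using hU 0 le_rfl x
    have hI := tendsto_inv_smul_integral_convolution hT0 hTiso hTcont
      (hBcont.comp (hUcont x))
    simp only [Function.comp_apply, hU0] at hI
    have hTx : Tendsto (fun t => T t x) (nhdsWithin 0 (Set.Ioi 0)) (nhds x) := by
      simpa [hT0] using ((hTcont x).tendsto 0).mono_left nhdsWithin_le_nhds
    have ht : Tendsto (fun t : ℝ => t / 2) (nhdsWithin 0 (Set.Ioi 0)) (nhds 0) := by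
      have hc : Continuous fun t : ℝ => t / 2 := by fun_prop
      simpa using (hc.tendsto 0).mono_left nhdsWithin_le_nhds
    have key := (hTx.inner hI).neg.add (ht.mul (hI.norm.pow 2))
    rw [zero_mul, add_zero] at key
    refine key.congr' ?_
    filter_upwards [self_mem_nhdsWithin] with t ht0
    have htpos : 0 < t := ht0
    rw [hU t htpos.le x, norm_sub_sq_real, hTiso t htpos.le, inner_smul_right, norm_smul,
      Real.norm_eq_abs, abs_of_pos (inv_pos.2 htpos)]
    field_simp
    ring
  refine ⟨hlim, fun c => ?_⟩
  ext x
  have hV : Vdot x = -⟪B x, x⟫ := by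
    rw [hVdot x, real_inner_comm]
    refine Tendsto.limsup_eq ((hlim x).congr fun t => ?_)
    rw [← mul_sub, ← div_div]
    ring
  simp only [Set.mem_ofPred_eq, hV]
end

section
/- Let X be a real Hilbert space. Let T : ℝ → (X →L[ℝ] X) satisfy: T 0 = id; ‖T t y‖ = ‖y‖ for all t ≥ 0 and y ∈ X; and for each y ∈ X the map t ↦ T t y is continuous. Let 𝔅 : X → X be continuous and monotone. Let U : ℝ → X → X be such that for each x ∈ X the map s ↦ U s x is continuous and U t x = T t x − ∫₀ᵗ T (t − s) (𝔅 (U s x)) ds for all t ≥ 0 and x ∈ X. Suppose s₀ ∈ X is a common fixed point of the flow, i.e. U t s₀ = s₀ for all t ≥ 0. Then for every x ∈ X the limit as t → 0⁺ of (‖U t x − s₀‖² − ‖x − s₀‖²) / (2 t) exists and equals −⟪x − s₀, 𝔅 x − 𝔅 s₀⟫; hence the upper Dini derivative of the shifted functional V_{s₀}(x) = (1/2)‖x − s₀‖² along the flow has level sets { x ∈ X | −⟪𝔅 x − 𝔅 s₀, x − s₀⟫ = c } (Theorem 4.4). -/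
open scoped RealInnerProductSpace
open Filter

open Topology

section IsometricFamily

variable {X : Type*} [NormedAddCommGroup X] [NormedSpace ℝ X]

/-- A strongly continuous family of isometries, frozen at negative times, is jointly continuous. -/
lemma continuous_isometricFamily_max {T : ℝ → X →L[ℝ] X}
    (hTiso : ∀ t : ℝ, 0 ≤ t → ∀ y : X, ‖T t y‖ = ‖y‖)
    (hTcont : ∀ y : X, Continuous fun t => T t y) :
    Continuous fun p : ℝ × X => T (max p.1 0) p.2 := by
  rw [continuous_iff_continuousAt]
  rintro ⟨r, v⟩
  have hdiff : Tendsto (fun p : ℝ × X => T (max p.1 0) (p.2 - v)) (𝓝 (r, v)) (𝓝 0) := by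
    rw [tendsto_zero_iff_norm_tendsto_zero]
    simp only [hTiso _ (le_max_right _ _)]
    have h : Continuous fun p : ℝ × X => ‖p.2 - v‖ := by fun_prop
    simpa using h.tendsto (r, v)
  have hbase : Tendsto (fun p : ℝ × X => T (max p.1 0) v) (𝓝 (r, v)) (𝓝 (T (max r 0) v)) :=
    ((hTcont v).comp (continuous_fst.max continuous_const)).tendsto (r, v)
  simpa [ContinuousAt] using hdiff.add hbase

lemma intervalIntegrable_isometricFamily_convolution {T : ℝ → X →L[ℝ] X}
    (hTiso : ∀ t : ℝ, 0 ≤ t → ∀ y : X, ‖T t y‖ = ‖y‖)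
    (hTcont : ∀ y : X, Continuous fun t => T t y)
    {w : ℝ → X} (hw : Continuous w) {t : ℝ} (ht : 0 ≤ t) :
    IntervalIntegrable (fun s => T (t - s) (w s)) MeasureTheory.volume 0 t := by
  have hcont : Continuous fun s : ℝ => T (max (t - s) 0) (w s) :=
    (continuous_isometricFamily_max hTiso hTcont).comp
      ((continuous_const.sub continuous_id).prodMk hw)
  refine ContinuousOn.intervalIntegrable (hcont.continuousOn.congr fun s hs => ?_)
  rw [Set.uIcc_of_le ht] at hs
  simp only [max_eq_left (sub_nonneg.2 hs.2)]

/-- The averages of the convolution of an isometric family with `w` converge to `w 0`. -/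
lemma tendsto_average_isometricFamily_convolution [CompleteSpace X] {T : ℝ → X →L[ℝ] X}
    (hT0 : T 0 = ContinuousLinearMap.id ℝ X)
    (hTiso : ∀ t : ℝ, 0 ≤ t → ∀ y : X, ‖T t y‖ = ‖y‖)
    (hTcont : ∀ y : X, Continuous fun t => T t y)
    {w : ℝ → X} (hw : Continuous w) :
    Tendsto (fun t : ℝ => t⁻¹ • ∫ s in (0 : ℝ)..t, T (t - s) (w s)) (𝓝[>] 0) (𝓝 (w 0)) := by
  have hcont : Continuous fun p : ℝ × ℝ => T (max (p.1 - p.2) 0) (w p.2) :=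
    (continuous_isometricFamily_max hTiso hTcont).comp
      ((continuous_fst.sub continuous_snd).prodMk (hw.comp continuous_snd))
  rw [Metric.tendsto_nhds]
  intro ε hε
  obtain ⟨δ, hδ, hclose⟩ := Metric.continuousAt_iff.1
    (hcont.continuousAt (x := ((0 : ℝ), (0 : ℝ)))) (ε / 2) (half_pos hε)
  filter_upwards [Ioo_mem_nhdsGT hδ] with t ht
  have htpos : 0 < t := ht.1
  have hbound : ∀ s ∈ Set.uIoc 0 t, ‖T (t - s) (w s) - w 0‖ ≤ ε / 2 := by
    intro s hs
    rw [Set.uIoc_of_le htpos.le] at hs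
    have h := @hclose (t, s) (by
      simp only [Prod.dist_eq, Real.dist_eq, sub_zero, abs_of_pos htpos, abs_of_pos hs.1]
      exact max_lt ht.2 (hs.2.trans_lt ht.2))
    simpa [hT0, max_eq_left (sub_nonneg.2 hs.2), dist_eq_norm] using h.le
  have hint := intervalIntegral.norm_integral_le_of_norm_le_const hbound
  rw [intervalIntegral.integral_sub
    (intervalIntegrable_isometricFamily_convolution hTiso hTcont hw htpos.le)
    intervalIntegrable_const, intervalIntegral.integral_const, sub_zero,
    abs_of_pos htpos] at hint
  rw [dist_eq_norm, ← inv_smul_smul₀ htpos.ne' (w 0), ← smul_sub, norm_smul, norm_inv,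
    Real.norm_of_nonneg htpos.le]
  calc t⁻¹ * _ ≤ t⁻¹ * (ε / 2 * t) := by gcongr
    _ = ε / 2 := by field_simp
    _ < ε := half_lt_self hε

end IsometricFamily

/-- **Theorem 4.4 (shifted version).** Under the hypotheses of Theorem 4.3, if `s₀` is a
common fixed point of the flow `U`, then for every `x` the right limit of
`(‖U t x - s₀‖² - ‖x - s₀‖²)/(2t)` at `0` exists and equals `-⟪x - s₀, 𝔅 x - 𝔅 s₀⟫`;
hence the upper Dini derivative of `V_{s₀}(x) = ½‖x - s₀‖²` along the flow has level
sets `{x | -⟪𝔅 x - 𝔅 s₀, x - s₀⟫ = c}`. -/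
theorem dini_derivative_levelsets_shifted
    {X : Type*} [NormedAddCommGroup X] [InnerProductSpace ℝ X] [CompleteSpace X]
    (T : ℝ → X →L[ℝ] X)
    (hT0 : T 0 = ContinuousLinearMap.id ℝ X)
    (hTiso : ∀ t : ℝ, 0 ≤ t → ∀ y : X, ‖T t y‖ = ‖y‖)
    (hTcont : ∀ y : X, Continuous fun t => T t y)
    (B : X → X) (hBcont : Continuous B)
    (hBmono : ∀ a b : X, 0 ≤ ⟪B a - B b, a - b⟫)
    (U : ℝ → X → X)
    (hUcont : ∀ x : X, Continuous fun s => U s x)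
    (hU : ∀ t : ℝ, 0 ≤ t → ∀ x : X,
      U t x = T t x - ∫ s in (0 : ℝ)..t, T (t - s) (B (U s x)))
    (s₀ : X) (hfix : ∀ t : ℝ, 0 ≤ t → U t s₀ = s₀)
    (Vdot : X → ℝ)
    (hVdot : ∀ x : X, Vdot x =
      limsup
        (fun t => ((1 / 2 : ℝ) * ‖U t x - s₀‖ ^ 2 - (1 / 2 : ℝ) * ‖x - s₀‖ ^ 2) / t)
        (nhdsWithin 0 (Set.Ioi 0))) :
    (∀ x : X,
      Tendsto (fun t => (‖U t x - s₀‖ ^ 2 - ‖x - s₀‖ ^ 2) / (2 * t))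
        (nhdsWithin 0 (Set.Ioi 0)) (nhds (-⟪x - s₀, B x - B s₀⟫))) ∧
    (∀ c : ℝ, {x : X | Vdot x = c} = {x : X | -⟪B x - B s₀, x - s₀⟫ = c}) := by
  have hlim : ∀ x : X,
      Tendsto (fun t => (‖U t x - s₀‖ ^ 2 - ‖x - s₀‖ ^ 2) / (2 * t))
        (𝓝[>] 0) (𝓝 (-⟪x - s₀, B x - B s₀⟫)) := by
    intro x
    have hU0 : ∀ y, U 0 y = y := fun y => by simpa [hT0] using hU 0 le_rfl y
    have hBU : ∀ y, Continuous fun s => B (U s y) := fun y => hBcont.comp (hUcont y)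
    set A : ℝ → X := fun t =>
      t⁻¹ • ∫ s in (0 : ℝ)..t, T (t - s) (B (U s x) - B (U s s₀)) with hA
    have hAlim : Tendsto A (𝓝[>] 0) (𝓝 (B x - B s₀)) := by
      simpa only [hU0, Pi.sub_apply] using tendsto_average_isometricFamily_convolution hT0 hTiso hTcont
        ((hBU x).sub (hBU s₀))
    have hTlim : Tendsto (fun t => T t (x - s₀)) (𝓝[>] 0) (𝓝 (x - s₀)) := by
      simpa [hT0] using ((hTcont (x - s₀)).tendsto 0).mono_left nhdsWithin_le_nhds
    have hid : Tendsto (fun t : ℝ => t / 2) (𝓝[>] 0) (𝓝 0) := by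
      simpa using ((continuous_id.div_const (2 : ℝ)).tendsto 0).mono_left nhdsWithin_le_nhds
    have hexp : Tendsto (fun t => -⟪T t (x - s₀), A t⟫ + t / 2 * ‖A t‖ ^ 2) (𝓝[>] 0)
        (𝓝 (-⟪x - s₀, B x - B s₀⟫)) := by
      simpa using (hTlim.inner hAlim).neg.add (hid.mul (hAlim.norm.pow 2))
    refine hexp.congr' ?_
    filter_upwards [self_mem_nhdsWithin] with t (ht : 0 < t)
    have hflow : U t x - s₀ = T t (x - s₀) - t • A t := by
      have hint := fun y =>
        intervalIntegrable_isometricFamily_convolution hTiso hTcont (hBU y) ht.le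
      simp only [hA, smul_inv_smul₀ ht.ne', map_sub]
      rw [intervalIntegral.integral_sub (hint x) (hint s₀)]
      nth_rewrite 1 [← hfix t ht.le]
      rw [hU t ht.le x, hU t ht.le s₀]
      abel
    rw [hflow, norm_sub_sq_real, hTiso t ht.le, inner_smul_right _ (A t) t,
      norm_smul t (A t), Real.norm_of_nonneg ht.le]
    field_simp
    ring
  refine ⟨hlim, fun c => Set.ext fun x => ?_⟩
  have hV : Vdot x = -⟪B x - B s₀, x - s₀⟫ := by
    rw [hVdot, real_inner_comm, ← (hlim x).limsup_eq]
    congr 1 with t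
    rw [← mul_sub, div_mul_eq_div_div]
    ring
  simp only [Set.mem_ofPred_eq, hV]
end

section
/- Let W be a real Hilbert space, M : W → W a monotone map, w⋆ ∈ W, β > 0, and Q : W →L[ℝ] W a bounded linear operator with ‖Q v‖ ≤ ‖v‖ for all v ∈ W. Assume the componentwise strong monotonicity estimate ⟪M a − M b, a − b⟫ ≥ β ‖Q (a − b)‖² for all a, b ∈ W. Let w : ℝ → W be such that for every t ≥ 0, w has derivative −M (w t) + M w⋆ at t. Then: (i) for all 0 ≤ s ≤ t, ‖w t − w⋆‖ ≤ ‖w s − w⋆‖; and (ii) for every t ≥ 0, ‖Q (w t − w⋆)‖² ≤ ‖w 0 − w⋆‖² − 2 β ∫₀ᵗ ‖Q (w τ − w⋆)‖² dτ (the estimates established in the proof of Theorem 4.7 on the primal–dual gradient dynamics). -/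
open scoped RealInnerProductSpace

/-- Energy dissipation along `w' = -M w + M w⋆`: on `[s, t]` the squared distance to `w⋆`
decreases by at least `2β ∫ ‖Q (w τ - w⋆)‖²`. -/
theorem norm_sub_sq_le_sub_integral
    {W : Type*} [NormedAddCommGroup W] [InnerProductSpace ℝ W]
    {M : W → W} {wstar : W} {β : ℝ} {Q : W →L[ℝ] W}
    (hstrong : ∀ a b : W, β * ‖Q (a - b)‖ ^ 2 ≤ ⟪M a - M b, a - b⟫)
    {w : ℝ → W} {s t : ℝ} (hst : s ≤ t)
    (hw : ∀ τ ∈ Set.Icc s t, HasDerivAt w (-M (w τ) + M wstar) τ) :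
    ‖w t - wstar‖ ^ 2
      ≤ ‖w s - wstar‖ ^ 2 - 2 * β * ∫ τ in s..t, ‖Q (w τ - wstar)‖ ^ 2 := by
  have hcont : ContinuousOn w (Set.Icc s t) :=
    fun τ hτ => (hw τ hτ).continuousAt.continuousWithinAt
  have hint : ContinuousOn (fun τ => -(2 * β) * ‖Q (w τ - wstar)‖ ^ 2) (Set.Icc s t) := by
    fun_prop
  have hderiv : ∀ τ ∈ Set.Icc s t, HasDerivAt (fun τ => ‖w τ - wstar‖ ^ 2)
      (2 * ⟪w τ - wstar, -M (w τ) + M wstar⟫) τ :=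
    fun τ hτ => ((hw τ hτ).sub_const wstar).norm_sq
  have hbound := intervalIntegral.sub_le_integral_of_hasDeriv_right_of_le hst
    (fun τ hτ => (hderiv τ hτ).continuousAt.continuousWithinAt)
    (fun τ hτ => (hderiv τ (Set.Ioo_subset_Icc_self hτ)).hasDerivWithinAt)
    hint.integrableOn_Icc (fun τ _ => by
      have hτ := hstrong (w τ) wstar
      rw [real_inner_comm] at hτ
      rw [show -M (w τ) + M wstar = -(M (w τ) - M wstar) by abel, inner_neg_right]
      linarith)
  rw [intervalIntegral.integral_const_mul] at hbound
  linarith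

/-- **Estimates from the proof of Theorem 4.7.** Let `M` be monotone on the real Hilbert
space `W` satisfying the componentwise strong monotonicity estimate
`⟪M a - M b, a - b⟫ ≥ β ‖Q (a - b)‖²` with `β > 0` and `‖Q v‖ ≤ ‖v‖`. If `w` solves
`w' = -M w + M w⋆` on `[0, ∞)`, then `t ↦ ‖w t - w⋆‖` is nonincreasing on `[0, ∞)` and
`‖Q (w t - w⋆)‖² ≤ ‖w 0 - w⋆‖² - 2β ∫₀ᵗ ‖Q (w τ - w⋆)‖² dτ` for all `t ≥ 0`. -/
theorem primal_dual_gradient_estimates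
    {W : Type*} [NormedAddCommGroup W] [InnerProductSpace ℝ W] [CompleteSpace W]
    (M : W → W)
    (hmono : ∀ a b : W, 0 ≤ ⟪M a - M b, a - b⟫)
    (wstar : W) (β : ℝ) (hβ : 0 < β)
    (Q : W →L[ℝ] W) (hQ : ∀ v : W, ‖Q v‖ ≤ ‖v‖)
    (hstrong : ∀ a b : W, β * ‖Q (a - b)‖ ^ 2 ≤ ⟪M a - M b, a - b⟫)
    (w : ℝ → W)
    (hw : ∀ t : ℝ, 0 ≤ t → HasDerivAt w (-M (w t) + M wstar) t) :
    (∀ s t : ℝ, 0 ≤ s → s ≤ t → ‖w t - wstar‖ ≤ ‖w s - wstar‖) ∧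
    (∀ t : ℝ, 0 ≤ t →
      ‖Q (w t - wstar)‖ ^ 2
        ≤ ‖w 0 - wstar‖ ^ 2 - 2 * β * ∫ τ in (0 : ℝ)..t, ‖Q (w τ - wstar)‖ ^ 2) := by
  constructor
  · intro s t hs hst
    have henergy := norm_sub_sq_le_sub_integral hstrong hst
      fun τ hτ => hw τ (hs.trans hτ.1)
    have hint : 0 ≤ ∫ τ in s..t, ‖Q (w τ - wstar)‖ ^ 2 :=
      intervalIntegral.integral_nonneg hst fun τ _ => by positivity
    have hdiss := mul_nonneg (mul_nonneg zero_le_two hβ.le) hint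
    exact le_of_pow_le_pow_left₀ two_ne_zero (norm_nonneg _) (by linarith)
  · intro t ht
    exact (pow_le_pow_left₀ (norm_nonneg _) (hQ _) 2).trans
      (norm_sub_sq_le_sub_integral hstrong ht fun τ hτ => hw τ hτ.1)
end
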